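/- Let K be a field whose automorphism group Aut(K) is abelian, let σ ∈ Aut(K) have finite order n with n ≥ m−1, and assume f and h do not generate two-sided ideals in K[t;σ]. Then the classes C_f and C_h of skew polycyclic codes of length m over K are equivalent if and only if they are isometric, and they are Chen equivalent if and only if they are Chen isometric. -/

import Mathlib

/-- `Nsig σ i β = ∏_{j=0}^{i-1} σ^j(β)`. -/
def Nsig {S : Type*} [CommRing S] (σ : S ≃+* S) (i : ℕ) (β : S) : S :=
  ∏ j ∈ Finset.range i, (σ ^ j) β

/-- The coefficient vector of the monomial `c·t^k` in `S^m`. -/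
def stdVec {S : Type*} [Ring S] (m k : ℕ) (c : S) : Fin m → S :=
  fun j => if (j : ℕ) = k then c else 0

/-- Left multiplication by `t`, followed by reduction modulo `f = t^m − ∑ a_i t^i`,
on coefficient vectors representing elements of the Petit algebra `S[t;σ]/S[t;σ]f`. -/
def tmul {S : Type*} [Ring S] (σ : S ≃+* S) {m : ℕ} (a : Fin m → S)
    (c : Fin m → S) : Fin m → S :=
  fun j =>
    (if _ : (j : ℕ) = 0 then 0 else σ (c ⟨(j : ℕ) - 1, by have := j.isLt; omega⟩)) +
      σ (c ⟨m - 1, by have := j.isLt; omega⟩) * a j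

/-- The multiplication of the Petit algebra `S[t;σ]/S[t;σ]f`, `f = t^m − ∑ a_i t^i`:
`g ∘ h` is the remainder of the skew-polynomial product `g·h` under right division by `f`. -/
def petitMul {S : Type*} [Ring S] (σ : S ≃+* S) {m : ℕ} (a : Fin m → S)
    (g h : Fin m → S) : Fin m → S :=
  fun j => ∑ i : Fin m, g i * (tmul σ a)^[(i : ℕ)] h j

/-- The map `G_{τ,α} : ∑ d_i t^i ↦ ∑ τ(d_i) N_i^σ(α) t^i` on coefficient vectors. -/
def Gmap {S : Type*} [CommRing S] (σ τ : S ≃+* S) (α : S) {m : ℕ}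
    (d : Fin m → S) : Fin m → S :=
  fun i => τ (d i) * Nsig σ (i : ℕ) α

/-- `G` is an isomorphism from the Petit algebra `S[t;σ]/S[t;σ](t^m − ∑ a_i t^i)` to the
Petit algebra `S[t;σ]/S[t;σ](t^m − ∑ b_i t^i)`: a bijective, additive, unital and
multiplicative map on coefficient vectors. -/
def IsPetitIso {S : Type*} [Ring S] (σ : S ≃+* S) {m : ℕ} (a b : Fin m → S)
    (G : (Fin m → S) → (Fin m → S)) : Prop :=
  Function.Bijective G ∧ (∀ x y, G (x + y) = G x + G y) ∧
    G (stdVec m 0 1) = stdVec m 0 1 ∧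
    (∀ x y, G (petitMul σ a x y) = petitMul σ b (G x) (G y))

/-- The map `G_{τ,α,k} : ∑ d_i t^i ↦ ∑ τ(d_i) (α t^k)^i mod_r h`, where
`h = t^m − ∑ b_i t^i`; one has `(α t^k)^i = N_i^{σ^k}(α) t^{k i}` in `S[t;σ]`. -/
def Gmapk {S : Type*} [CommRing S] (σ τ : S ≃+* S) (α : S) (k : ℕ) {m : ℕ}
    (b : Fin m → S) (d : Fin m → S) : Fin m → S :=
  ∑ i : Fin m, (τ (d i) * Nsig (σ ^ k) (i : ℕ) α) • (tmul σ b)^[k * (i : ℕ)] (stdVec m 0 1)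

theorem tmul_stdVec {S : Type*} [Ring S] (σ : S ≃+* S) {m : ℕ} (a : Fin m → S) {j : ℕ}
    (hj : j + 1 < m) (c : S) : tmul σ a (stdVec m j c) = stdVec m (j + 1) (σ c) := by
  funext i
  have hm : m - 1 ≠ j := by omega
  by_cases hi : (i : ℕ) = 0
  · have : (0 : ℕ) ≠ j + 1 := by omega
    simp [tmul, stdVec, hi, hm]
  · have : ((i : ℕ) - 1 = j) ↔ ((i : ℕ) = j + 1) := by omega
    simp [tmul, stdVec, hi, hm, this, apply_ite σ]

theorem tmul_iterate_stdVec_zero {S : Type*} [Ring S] (σ : S ≃+* S) {m : ℕ} (a : Fin m → S)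
    {i : ℕ} (hi : i < m) (c : S) :
    (tmul σ a)^[i] (stdVec m 0 c) = stdVec m i ((σ ^ i) c) := by
  induction i with
  | zero => simp
  | succ i ih =>
    rw [Function.iterate_succ_apply', ih (by omega), tmul_stdVec σ a hi, pow_succ']
    rfl

theorem petitMul_stdVec_left {S : Type*} [Ring S] (σ : S ≃+* S) {m : ℕ} (a : Fin m → S)
    {i : ℕ} (hi : i < m) (c : S) (y : Fin m → S) :
    petitMul σ a (stdVec m i c) y = c • (tmul σ a)^[i] y := by
  funext j
  simp only [petitMul, stdVec, Pi.smul_apply, smul_eq_mul]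
  rw [Finset.sum_eq_single ⟨i, hi⟩]
  · simp
  · intro k _ hk
    have : (k : ℕ) ≠ i := fun h => hk (Fin.ext h)
    simp [this]
  · simp

theorem petitMul_stdVec_zero_right {S : Type*} [Ring S] (σ : S ≃+* S) {m : ℕ} (a : Fin m → S)
    (x : Fin m → S) (c : S) (j : Fin m) :
    petitMul σ a x (stdVec m 0 c) j = x j * (σ ^ (j : ℕ)) c := by
  simp only [petitMul]
  rw [Finset.sum_eq_single j]
  · simp [tmul_iterate_stdVec_zero σ a j.isLt, stdVec]
  · intro k _ hk
    have : (j : ℕ) ≠ k := fun h => hk (Fin.ext h.symm)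
    simp [tmul_iterate_stdVec_zero σ a k.isLt, stdVec, this]
  · simp

theorem sum_stdVec {S : Type*} [Ring S] {m : ℕ} (d : Fin m → S) :
    ∑ i : Fin m, stdVec m i (d i) = d := by
  funext j
  simp [Finset.sum_apply, stdVec, ← Fin.ext_iff]

theorem Gmapk_stdVec_zero {S : Type*} [CommRing S] (σ τ : S ≃+* S) (α : S) (k : ℕ) {m : ℕ}
    (hm : 0 < m) (b : Fin m → S) (c : S) :
    Gmapk σ τ α k b (stdVec m 0 c) = stdVec m 0 (τ c) := by
  unfold Gmapk
  rw [Finset.sum_eq_single ⟨0, hm⟩]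
  · funext j
    simp [stdVec, Nsig]
  · intro i _ hi
    have : (i : ℕ) ≠ 0 := fun h => hi (Fin.ext h)
    simp [stdVec, this]
  · simp

theorem Gmapk_one {S : Type*} [CommRing S] (σ τ : S ≃+* S) (α : S) {m : ℕ}
    (b : Fin m → S) : Gmapk σ τ α 1 b = Gmap σ τ α := by
  funext d
  rw [← sum_stdVec (Gmap σ τ α d)]
  refine Finset.sum_congr rfl fun i _ => ?_
  rw [one_mul, tmul_iterate_stdVec_zero σ b i.isLt]
  funext j
  simp [stdVec, Gmap]

theorem smul_stdVec {S : Type*} [Ring S] (m k : ℕ) (c d : S) :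
    c • stdVec m k d = stdVec m k (c * d) := by
  funext j
  simp [stdVec]

theorem Nsig_succ {S : Type*} [CommRing S] (σ : S ≃+* S) (i : ℕ) (β : S) :
    Nsig σ (i + 1) β = β * σ (Nsig σ i β) := by
  simp only [Nsig, Finset.prod_range_succ', map_prod, pow_zero, pow_succ']
  rw [mul_comm]
  rfl

/-- A multiplicative additive map sending constants to constants via `τ` and `t` to a multiple
`α·t` is `G_{τ,α}`. -/
theorem eq_Gmap {S : Type*} [CommRing S] (σ τ : S ≃+* S) {m : ℕ} (hm : 1 < m)
    (a b : Fin m → S) (G : (Fin m → S) → (Fin m → S)) (α : S)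
    (hadd : ∀ x y, G (x + y) = G x + G y)
    (hmul : ∀ x y, G (petitMul σ a x y) = petitMul σ b (G x) (G y))
    (hc : ∀ c, G (stdVec m 0 c) = stdVec m 0 (τ c))
    (ht : G (stdVec m 1 1) = stdVec m 1 α) : G = Gmap σ τ α := by
  have hpow : ∀ i, i < m → G (stdVec m i 1) = stdVec m i (Nsig σ i α) := by
    intro i
    induction i with
    | zero => intro _; simp [hc, Nsig]
    | succ i ih =>
      intro hi
      have h := hmul (stdVec m 1 1) (stdVec m i 1)
      rw [petitMul_stdVec_left σ a hm, ht, petitMul_stdVec_left σ b hm, ih (by omega),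
        Function.iterate_one, Function.iterate_one, tmul_stdVec σ a hi, tmul_stdVec σ b hi,
        one_smul, map_one, smul_stdVec] at h
      rw [h, Nsig_succ]
  have hmono : ∀ (i : Fin m) (c : S), G (stdVec m i c) = stdVec m i (τ c * Nsig σ i α) := by
    intro i c
    have h := hmul (stdVec m 0 c) (stdVec m i 1)
    rwa [petitMul_stdVec_left σ a (by omega), hc, petitMul_stdVec_left σ b (by omega),
      hpow i i.isLt, Function.iterate_zero_apply, Function.iterate_zero_apply,
      smul_stdVec, smul_stdVec, mul_one] at h
  funext d
  have hsum := map_sum (AddMonoidHom.mk' G hadd) (fun i : Fin m => stdVec m i (d i)) Finset.univ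
  simp only [AddMonoidHom.mk'_apply, sum_stdVec, hmono] at hsum
  rw [hsum]
  rfl

theorem petitMul_assoc_of_eq_one {S : Type*} [CommRing S] (a x y z : Fin 2 → S) :
    petitMul (1 : S ≃+* S) a (petitMul 1 a x y) z = petitMul 1 a x (petitMul 1 a y z) := by
  funext j
  fin_cases j <;> simp [petitMul, tmul, Fin.sum_univ_two] <;> ring

/-- An isomorphism of nonassociative Petit algebras extending an automorphism `τ` of `K` that
commutes with `σ` maps `t` to a scalar multiple of `t`. -/
theorem exists_apply_t_eq {K : Type*} [Field K] {σ τ : K ≃+* K} (hcomm : τ * σ = σ * τ)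
    {m : ℕ} (hm : 1 < m) (hord : 2 ≤ orderOf σ) (hnm : m - 1 ≤ orderOf σ)
    {a b : Fin m → K} {G : (Fin m → K) → (Fin m → K)} (hG : IsPetitIso σ a b G)
    (hc : ∀ c, G (stdVec m 0 c) = stdVec m 0 (τ c)) :
    ∃ α : K, α ≠ 0 ∧ G (stdVec m 1 1) = stdVec m 1 α := by
  obtain ⟨hbij, hadd, -, hmul⟩ := hG
  set g := G (stdVec m 1 1) with hg
  have key : ∀ (c : K) (j : Fin m), g j * (σ ^ (j : ℕ)) (τ c) = τ (σ c) * g j := by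
    intro c j
    have h1 := hmul (stdVec m 1 1) (stdVec m 0 c)
    have h2 := hmul (stdVec m 0 (σ c)) (stdVec m 1 1)
    rw [petitMul_stdVec_left σ a hm, Function.iterate_one, tmul_stdVec σ a hm, one_smul, hc] at h1
    rw [petitMul_stdVec_left σ a (by omega), hc, petitMul_stdVec_left σ b (by omega),
      Function.iterate_zero_apply, Function.iterate_zero_apply, smul_stdVec, mul_one] at h2
    rw [← petitMul_stdVec_zero_right σ b g (τ c) j, ← h1]
    exact congrFun h2 j
  have hzero : ∀ j : Fin m, (j : ℕ) ≠ 1 → g j = 0 := by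
    intro j hj
    by_contra hgj
    apply hj
    have hpow : σ ^ (j : ℕ) = σ ^ 1 := by
      ext c
      have h := key (τ.symm c) j
      rw [mul_comm, RingEquiv.apply_symm_apply] at h
      have h' : τ (σ (τ.symm c)) = σ (τ (τ.symm c)) := DFunLike.congr_fun hcomm _
      rw [h', RingEquiv.apply_symm_apply] at h
      simpa using mul_right_cancel₀ hgj h
    have hmod := pow_eq_pow_iff_modEq.mp hpow
    have hjm := j.isLt
    rw [Nat.ModEq, Nat.mod_eq_of_lt (show 1 < orderOf σ by omega)] at hmod
    rcases Nat.lt_or_ge (j : ℕ) (orderOf σ) with hlt | hge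
    · rwa [Nat.mod_eq_of_lt hlt] at hmod
    · rw [show (j : ℕ) = orderOf σ by omega, Nat.mod_self] at hmod
      omega
  have hgt : g = stdVec m 1 (g ⟨1, hm⟩) := by
    funext j
    by_cases hj : (j : ℕ) = 1
    · simp only [stdVec, hj, if_true]
      exact congrArg g (Fin.ext hj)
    · simp [stdVec, hj, hzero j hj]
  refine ⟨g ⟨1, hm⟩, fun h0 => ?_, hgt⟩
  have hG0 : G 0 = 0 := map_zero (AddMonoidHom.mk' G hadd)
  have hg0 : g = 0 := by
    rw [hgt, h0]
    funext j
    simp [stdVec]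
  have h10 := congrFun (hbij.1 (hg0.trans hG0.symm)) ⟨1, hm⟩
  simp [stdVec] at h10

/-- **Theorem.**  Let `K` be a field with abelian automorphism group, `σ ∈ Aut(K)` of
finite order `n ≥ m − 1`, and assume `f` and `h` do not generate two-sided ideals in
`K[t;σ]` (equivalently, the Petit algebras are not associative).  Then the classes `C_f`
and `C_h` of skew polycyclic codes of length `m` over `K` are equivalent iff they are
isometric, and Chen equivalent iff they are Chen isometric. -/
theorem stmt13 {K : Type*} [Field K] (σ : K ≃+* K)
    (habel : ∀ ρ₁ ρ₂ : K ≃+* K, ρ₁ * ρ₂ = ρ₂ * ρ₁)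
    (n : ℕ) (hn : 0 < n) (hord : orderOf σ = n)
    (m : ℕ) (hm : 1 < m) (hnm : m - 1 ≤ n)
    (a b : Fin m → K)
    (hf : ¬ ∀ x y z : Fin m → K,
      petitMul σ a (petitMul σ a x y) z = petitMul σ a x (petitMul σ a y z))
    (hh : ¬ ∀ x y z : Fin m → K,
      petitMul σ b (petitMul σ b x y) z = petitMul σ b x (petitMul σ b y z)) :
    ((∃ (τ : K ≃+* K) (α : K), α ≠ 0 ∧ IsPetitIso σ a b (Gmapk σ τ α 1 b)) ↔
      (∃ (τ : K ≃+* K) (α : K) (k : ℕ), α ≠ 0 ∧ 1 ≤ k ∧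
        IsPetitIso σ a b (Gmapk σ τ α k b))) ∧
    ((∃ α : K, α ≠ 0 ∧ IsPetitIso σ a b (Gmapk σ (RingEquiv.refl K) α 1 b)) ↔
      (∃ (α : K) (k : ℕ), α ≠ 0 ∧ 1 ≤ k ∧
        IsPetitIso σ a b (Gmapk σ (RingEquiv.refl K) α k b))) := by
  have h2 : 2 ≤ orderOf σ := by
    by_contra hlt
    have h1 : orderOf σ = 1 := by omega
    obtain rfl := orderOf_eq_one_iff.mp h1
    obtain rfl : m = 2 := by omega
    exact hf (petitMul_assoc_of_eq_one a)
  have key : ∀ (τ : K ≃+* K) (α : K) (k : ℕ), IsPetitIso σ a b (Gmapk σ τ α k b) →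
      ∃ β : K, β ≠ 0 ∧ IsPetitIso σ a b (Gmapk σ τ β 1 b) := by
    intro τ α k hG
    have hc := Gmapk_stdVec_zero σ τ α k (by omega : 0 < m) b
    obtain ⟨β, hβ, ht⟩ := exists_apply_t_eq (habel τ σ) hm h2 (by omega) hG hc
    refine ⟨β, hβ, ?_⟩
    rw [Gmapk_one, ← eq_Gmap σ τ hm a b _ β hG.2.1 hG.2.2.2 hc ht]
    exact hG
  refine ⟨⟨?_, ?_⟩, ⟨?_, ?_⟩⟩
  · rintro ⟨τ, α, hα, hG⟩
    exact ⟨τ, α, 1, hα, le_rfl, hG⟩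
  · rintro ⟨τ, α, k, -, -, hG⟩
    exact ⟨τ, key τ α k hG⟩
  · rintro ⟨α, hα, hG⟩
    exact ⟨α, 1, hα, le_rfl, hG⟩
  · rintro ⟨α, k, -, -, hG⟩
    exact key _ α k hG
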